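/- Let A be a reduced (minimal) complete deterministic finite automaton over a finite alphabet Σ with transition graph Γ, and let L be the set of nonempty words accepted by A. For states p, q, r₁ of Γ such that (p,r₁) is a C-node, p ⪰ q, and there exists a state r with (q,r) a C-node and p ⪰ r ⪰ r₁, define T(p,q,r₁) = { t : (p,r₁) ⪰ (q,t) in Γ², q ⪰ t, and (q,t) is a C-node }. Then L is locally threshold testable if and only if: (1) for every C-node (p,q) of Γ², p ∼ q implies p = q; (2) for all states p, q, t, r₁ such that (p,r₁) is a C-node, (p,r₁) ⪰ (q,t) in Γ², and there exists a state r with p ⪰ r ⪰ r₁ and (r,t) a C-node, one has q ⪰ t; (3) for all p, q, r₁ as in the definition above, any two elements of T(p,q,r₁) satisfy t ∼ t' (i.e., T(p,q,r₁) is contained in a single strongly connected component of Γ, so that when nonempty it determines an SCC denoted T3_SCC(p,q,r₁)); (4) for all states p, q, r, q₁ such that (p,q₁) and (q,r) are C-nodes of Γ², p ⪰ q, p ⪰ r, and there exists a state r₁ with (q,r) ⪰ (q₁,r₁) in Γ² and (p,r₁) a C-node, every element of T(p,q,r₁) is ∼-equivalent to every element of T(p,r,q₁), i.e., T3_SCC(p,q,r₁)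 = T3_SCC(p,r,q₁). -/

import Mathlib

/-- Extended transition function of a DFA. -/
def deltaStar {Q A : Type*} (δ : Q → A → Q) (q : Q) (w : List A) : Q :=
  w.foldl δ q

/-- `p ⪰ q` : the state `q` is reachable from `p`. -/
def Reach {Q A : Type*} (δ : Q → A → Q) (p q : Q) : Prop :=
  ∃ w : List A, deltaStar δ p w = q

/-- `(p, q)` is a C-node of `Γ²`: some nonempty word fixes both `p` and `q`. -/
def CNode {Q A : Type*} (δ : Q → A → Q) (p q : Q) : Prop :=
  ∃ w : List A, w ≠ [] ∧ deltaStar δ p w = p ∧ deltaStar δ q w = q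

/-- The set `T(p,q,r₁) = { t | (p,r₁) ⪰ (q,t) in Γ², q ⪰ t, (q,t) is a C-node }`. -/
def TSet {Q A : Type*} (δ : Q → A → Q) (p q r₁ : Q) : Set Q :=
  {t : Q | (∃ w : List A, deltaStar δ p w = q ∧ deltaStar δ r₁ w = t) ∧
    Reach δ q t ∧ CNode δ q t}

/-- Number of occurrences of the word `f` in the word `w`. -/
def occCount {A : Type*} [DecidableEq A] (f w : List A) : ℕ :=
  ((List.range (w.length + 1 - f.length)).filter
    fun i => (w.drop i).take f.length = f).length

/-- `L` is `l`-threshold `k`-testable. -/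
def LThresholdKTestable {A : Type*} [DecidableEq A]
    (L : Set (List A)) (l k : ℕ) : Prop :=
  ∀ u v : List A, u ≠ [] → v ≠ [] →
    u.take (k - 1) = v.take (k - 1) →
    u.drop (u.length - (k - 1)) = v.drop (v.length - (k - 1)) →
    (∀ j ≤ l, ∀ f : List A, f.length = k → (j ≤ occCount f u ↔ j ≤ occCount f v)) →
    (u ∈ L ↔ v ∈ L)

/-- `L` is locally threshold testable. -/
def LocallyThresholdTestable {A : Type*} [DecidableEq A] (L : Set (List A)) : Prop :=
  ∃ k ≥ 1, ∃ l ≥ 1, LThresholdKTestable L l k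

section GraphPaths

open Classical

variable {V E X : Type*}

/-- The list of edges `l` is a path from `c` to `d`. -/
def IsPath (src tgt : E → V) : V → List E → V → Prop
  | c, [], d => c = d
  | c, a :: l, d => src a = c ∧ IsPath src tgt (tgt a) l d

/-- The path `l` starting at `v` visits the vertex `m`. -/
def Visits (src tgt : E → V) (v : V) (l : List E) (m : V) : Prop :=
  ∃ l₁ l₂, l = l₁ ++ l₂ ∧ IsPath src tgt v l₁ m

variable {src tgt : E → V}

theorem isPath_append {c d : V} {l₁ l₂ : List E} :
    IsPath src tgt c (l₁ ++ l₂) d ↔ ∃ m, IsPath src tgt c l₁ m ∧ IsPath src tgt m l₂ d := by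
  induction l₁ generalizing c with
  | nil => simp [IsPath]
  | cons a l ih => simp [IsPath, ih, and_assoc]

theorem IsPath.append {c m d : V} {l₁ l₂ : List E} (h₁ : IsPath src tgt c l₁ m)
    (h₂ : IsPath src tgt m l₂ d) : IsPath src tgt c (l₁ ++ l₂) d :=
  isPath_append.2 ⟨m, h₁, h₂⟩

theorem IsPath.target_unique {c d d' : V} {l : List E} (h : IsPath src tgt c l d)
    (h' : IsPath src tgt c l d') : d = d' := by
  induction l generalizing c with
  | nil => exact h.symm.trans h'
  | cons a l ih => exact ih h.2 h'.2

theorem IsPath.replicate {c : V} {x : List E} (h : IsPath src tgt c x c) (n : ℕ) :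
    IsPath src tgt c (List.replicate n x).flatten c := by
  induction n with
  | zero => exact rfl
  | succ n ih => simpa [List.replicate_succ] using h.append ih

theorem IsPath.visits_src {c d : V} {l : List E} (h : IsPath src tgt c l d) {a : E}
    (ha : a ∈ l) : Visits src tgt c l (src a) := by
  obtain ⟨s, t, rfl⟩ := List.append_of_mem ha
  obtain ⟨m, h₁, h₂⟩ := isPath_append.1 h
  exact ⟨s, a :: t, rfl, h₂.1 ▸ h₁⟩

theorem IsPath.visits_tgt {c d : V} {l : List E} (h : IsPath src tgt c l d) {a : E}
    (ha : a ∈ l) : Visits src tgt c l (tgt a) := by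
  obtain ⟨s, t, rfl⟩ := List.append_of_mem ha
  obtain ⟨m, h₁, h₂⟩ := isPath_append.1 h
  exact ⟨s ++ [a], t, by simp, h₁.append ⟨h₂.1, rfl⟩⟩

theorem visits_start (v : V) (l : List E) : Visits src tgt v l v :=
  ⟨[], l, rfl, rfl⟩

theorem Visits.split {v m d : V} {l : List E} (h : Visits src tgt v l m)
    (hl : IsPath src tgt v l d) :
    ∃ l₁ l₂, l = l₁ ++ l₂ ∧ IsPath src tgt v l₁ m ∧ IsPath src tgt m l₂ d := by
  obtain ⟨l₁, l₂, rfl, h₁⟩ := h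
  obtain ⟨m', h₁', h₂⟩ := isPath_append.1 hl
  obtain rfl := h₁.target_unique h₁'
  exact ⟨l₁, l₂, rfl, h₁, h₂⟩

theorem IsPath.balance {c d : V} {l : List E} (h : IsPath src tgt c l d) :
    d ::ₘ (l : Multiset E).map src = c ::ₘ (l : Multiset E).map tgt := by
  induction l generalizing c with
  | nil => obtain rfl : c = d := h; rfl
  | cons a l ih =>
    rw [← Multiset.cons_coe, Multiset.map_cons, Multiset.map_cons, Multiset.cons_swap, ih h.2, h.1]

theorem IsPath.exists_nodup {c d : V} {l : List E} (h : IsPath src tgt c l d) :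
    ∃ l', l'.Nodup ∧ l' ⊆ l ∧ IsPath src tgt c l' d := by
  induction l generalizing c with
  | nil => exact ⟨[], List.nodup_nil, fun _ h => h, h⟩
  | cons a l ih =>
    obtain ⟨l', hn, hs, hp⟩ := ih h.2
    by_cases ha : a ∈ l'
    · obtain ⟨s, t, rfl⟩ := List.append_of_mem ha
      obtain ⟨m, -, h₂⟩ := isPath_append.1 hp
      refine ⟨a :: t, (List.nodup_append.1 hn).2.1, fun b hb => ?_, h.1, h₂.2⟩
      exact List.mem_cons_of_mem _ (hs (List.mem_append_right _ hb))
    · refine ⟨a :: l', List.nodup_cons.2 ⟨ha, hn⟩, ?_, h.1, hp⟩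
      exact List.cons_subset_cons _ hs

theorem IsPath.exists_nodup_loop {c : V} {l : List E} (h : IsPath src tgt c l c) (hne : l ≠ []) :
    ∃ l', l'.Nodup ∧ l' ⊆ l ∧ l' ≠ [] ∧ IsPath src tgt c l' c := by
  obtain _ | ⟨a, l⟩ := l
  · exact absurd rfl hne
  obtain ⟨l', hn, hs, hp⟩ := h.2.exists_nodup
  obtain rfl := h.1
  by_cases ha : a ∈ l'
  · obtain ⟨s, t, rfl⟩ := List.append_of_mem ha
    obtain ⟨m, h₁, h₂⟩ := isPath_append.1 hp
    have hn' := List.nodup_append.1 hn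
    refine ⟨a :: s, List.nodup_cons.2 ⟨fun has => ?_, hn'.1⟩, ?_, by simp, rfl, h₂.1 ▸ h₁⟩
    · exact hn'.2.2 a has a (by simp) rfl
    · exact List.cons_subset_cons _ fun b hb => hs (List.mem_append_left _ hb)
  · exact ⟨a :: l', List.nodup_cons.2 ⟨ha, hn⟩, List.cons_subset_cons _ hs, by simp, rfl, hp⟩

/-- In a circulation, every edge lies on a loop. -/
theorem exists_loop_of_circulation {R : Multiset E} (hR : R.map src = R.map tgt) {a : E}
    (ha : a ∈ R) :
    ∃ w : List E, w ≠ [] ∧ IsPath src tgt (src a) w (src a) ∧ (w : Multiset E) ≤ R := by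
  have key : ∀ n : ℕ, ∀ (w : List E) (m : V), w ≠ [] → IsPath src tgt (src a) w m →
      (w : Multiset E) ≤ R → R.card ≤ w.length + n →
      ∃ w : List E, w ≠ [] ∧ IsPath src tgt (src a) w (src a) ∧ (w : Multiset E) ≤ R := by
    intro n
    induction n with
    | zero =>
      intro w m hw hp hle hc
      have hwR : (w : Multiset E) = R := Multiset.eq_of_le_of_card_le hle (by simpa using hc)
      refine ⟨w, hw, ?_, hle⟩
      have hb := hp.balance
      rw [hwR, hR] at hb
      rw [Multiset.cons_inj_left] at hb
      rwa [hb] at hp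
    | succ n ih =>
      intro w m hw hp hle hc
      by_cases hm : m = src a
      · exact ⟨w, hw, hm ▸ hp, hle⟩
      obtain ⟨R', rfl⟩ := Multiset.le_iff_exists_add.1 hle
      have hb := hp.balance
      have h₁ : src a ::ₘ R'.map src = m ::ₘ R'.map tgt := by
        rw [Multiset.map_add, Multiset.map_add] at hR
        rw [← Multiset.singleton_add, ← Multiset.singleton_add] at hb ⊢
        refine add_left_cancel (a := (w : Multiset E).map tgt) ?_
        calc _ = (({src a} : Multiset V) + (w : Multiset E).map tgt) + R'.map src := by abel
          _ = {m} + ((w : Multiset E).map src + R'.map src) := by rw [← hb]; abel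
          _ = _ := by rw [hR]; abel
      have h₂ : m ∈ R'.map src := by
        have : m ∈ src a ::ₘ R'.map src := h₁ ▸ Multiset.mem_cons_self _ _
        exact (Multiset.mem_cons.1 this).resolve_left hm
      obtain ⟨b, hb', rfl⟩ := Multiset.mem_map.1 h₂
      refine ih (w ++ [b]) (tgt b) (by simp) (hp.append ⟨rfl, rfl⟩) ?_ (by simp at hc ⊢; omega)
      rw [← Multiset.coe_add]
      exact add_le_add le_rfl (Multiset.singleton_le.2 hb')
  exact key R.card [a] (tgt a) (by simp) ⟨rfl, rfl⟩ (by simpa using ha) (by simp)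

theorem exists_mem_visits {q : List E} {R : Multiset E} {c d : V} (hq : IsPath src tgt c q d)
    {p : List E} {v e : V} (hp : IsPath src tgt v p e) (hv : Visits src tgt c q v)
    (hR : ∃ a ∈ p, a ∈ R) (hcov : ∀ a ∈ p, a ∈ q ∨ a ∈ R) :
    ∃ a ∈ R, Visits src tgt c q (src a) := by
  induction p generalizing v with
  | nil => simp at hR
  | cons b p ih =>
    by_cases hb : b ∈ R
    · exact ⟨b, hb, hp.1 ▸ hv⟩
    · refine ih hp.2 (hq.visits_tgt ((hcov b (by simp)).resolve_right hb)) ?_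
        fun a ha => hcov a (List.mem_cons_of_mem _ ha)
      obtain ⟨a, ha, haR⟩ := hR
      obtain rfl | ha := List.mem_cons.1 ha
      · exact absurd haR hb
      · exact ⟨a, ha, haR⟩

/-- A balanced multiset of edges with the same support as a path is the multiset of edges of a
path. -/
theorem IsPath.exists_of_balanced {c d : V} {p : List E} (hp : IsPath src tgt c p d)
    {M : Multiset E} (hM : ∀ a, a ∈ M ↔ a ∈ p)
    (hbal : d ::ₘ M.map src = c ::ₘ M.map tgt) :
    ∃ q : List E, IsPath src tgt c q d ∧ (q : Multiset E) = M := by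
  have key : ∀ n : ℕ, ∀ q : List E, IsPath src tgt c q d → (q : Multiset E) ≤ M →
      M.card ≤ q.length + n → ∃ q : List E, IsPath src tgt c q d ∧ (q : Multiset E) = M := by
    intro n
    induction n with
    | zero =>
      intro q hq hle hc
      exact ⟨q, hq, Multiset.eq_of_le_of_card_le hle (by simpa using hc)⟩
    | succ n ih =>
      intro q hq hle hc
      obtain ⟨R, rfl⟩ := Multiset.le_iff_exists_add.1 hle
      by_cases hR0 : R = 0
      · exact ⟨q, hq, by simp [hR0]⟩
      have hR : R.map src = R.map tgt := by
        have hb := hq.balance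
        rw [Multiset.map_add, Multiset.map_add, ← Multiset.cons_add,
          ← Multiset.cons_add, hb] at hbal
        exact add_left_cancel hbal
      obtain ⟨a₀, ha₀⟩ := Multiset.exists_mem_of_ne_zero hR0
      obtain ⟨a, haR, hav⟩ := exists_mem_visits hq hp (visits_start c q)
        ⟨a₀, (hM a₀).1 (Multiset.mem_add.2 (Or.inr ha₀)), ha₀⟩
        fun a ha => by simpa using (hM a).2 ha
      obtain ⟨w, hw, hwp, hwR⟩ := exists_loop_of_circulation hR haR
      obtain ⟨q₁, q₂, rfl, h₁, h₂⟩ := hav.split hq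
      refine ih (q₁ ++ (w ++ q₂)) (h₁.append (hwp.append h₂)) ?_ ?_
      · have : ((q₁ ++ (w ++ q₂) : List E) : Multiset E) =
            ((q₁ ++ q₂ : List E) : Multiset E) + w := by
          simp only [← Multiset.coe_add]; abel
        rw [this]
        exact add_le_add le_rfl hwR
      · have := List.length_pos_iff.2 hw
        simp at hc ⊢
        omega
  obtain ⟨q, hn, hs, hq⟩ := hp.exists_nodup
  refine key M.card q hq ?_ (by simp)
  rw [Multiset.le_iff_subset (by simpa using hn)]
  exact fun a ha => (hM a).2 (hs (by simpa using ha))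

/-- Exchanging coterminal segments of a path starting at `c₀` does not change `F`. -/
def SwapInvariant (src tgt : E → V) (c₀ : V) (F : List E → X) : Prop :=
  ∀ (c d e : V) (α x y z β : List E), IsPath src tgt c₀ α c → IsPath src tgt c x d →
    IsPath src tgt d y c → IsPath src tgt c z d → IsPath src tgt d β e →
    F (α ++ (x ++ (y ++ (z ++ β)))) = F (α ++ (z ++ (y ++ (x ++ β))))

/-- On paths starting at `c₀`, `F` does not distinguish `N`-th and `N+1`-st powers of a loop. -/
def PowInvariant (src tgt : E → V) (c₀ : V) (N : ℕ) (F : List E → X) : Prop :=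
  ∀ (c e : V) (α x β : List E), IsPath src tgt c₀ α c → IsPath src tgt c x c →
    IsPath src tgt c β e →
    F (α ++ ((List.replicate N x).flatten ++ β)) =
      F (α ++ ((List.replicate (N + 1) x).flatten ++ β))

theorem SwapInvariant.exists_head {c₀ : V} {F : List E → X} (hF : SwapInvariant src tgt c₀ F)
    {c d : V} {α x y p : List E} {b : E} (hα : IsPath src tgt c₀ α c)
    (hxy : IsPath src tgt c (x ++ b :: y) d) (hp : IsPath src tgt c (b :: p) d)
    (hx : x ≠ []) (hperm : (x ++ y).Perm p) :
    ∃ l, IsPath src tgt c (b :: l) d ∧ l.Perm (x ++ y) ∧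
      F (α ++ (x ++ b :: y)) = F (α ++ b :: l) := by
  obtain ⟨c', hxp, hby⟩ := isPath_append.1 hxy
  obtain rfl : c' = c := hby.1.symm.trans hp.1
  by_cases hm : ∃ m, Visits src tgt c' x m ∧ Visits src tgt (tgt b) y m
  · obtain ⟨m, hmx, hmy⟩ := hm
    obtain ⟨x₁, x₂, rfl, hx₁, hx₂⟩ := hmx.split hxp
    obtain ⟨y₁, y₂, rfl, hy₁, hy₂⟩ := hmy.split hby.2
    have hby₁ : IsPath src tgt c' (b :: y₁) m := ⟨hby.1, hy₁⟩
    refine ⟨y₁ ++ (x₂ ++ (x₁ ++ y₂)), ?_, ?_, ?_⟩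
    · exact hby₁.append (hx₂.append (hx₁.append hy₂))
    · rw [← Multiset.coe_eq_coe]
      simp only [← Multiset.coe_add]; abel
    · simpa using hF _ _ _ α x₁ x₂ (b :: y₁) y₂ hα hx₁ hx₂ hby₁ hy₂
  · exfalso
    push Not at hm
    have stay : ∀ (l : List E) (v : V), IsPath src tgt v l d → Visits src tgt (tgt b) y v →
        (∀ a ∈ l, a ∈ x ∨ a ∈ y) → ∀ a ∈ l, Visits src tgt (tgt b) y (src a) := by
      intro l
      induction l with
      | nil => simp
      | cons a l ih =>
        intro v hl hv hcov
        have hay : a ∈ y := (hcov a (by simp)).resolve_left fun hax =>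
          hm _ (hxp.visits_src hax) (hl.1 ▸ hv)
        have := ih (tgt a) hl.2 (hby.2.visits_tgt hay) fun a ha =>
          hcov a (List.mem_cons_of_mem _ ha)
        simp only [List.mem_cons, forall_eq_or_imp]
        exact ⟨hl.1 ▸ hv, this⟩
    obtain _ | ⟨a, x⟩ := x
    · exact hx rfl
    have ha := stay p (tgt b) hp.2 (visits_start _ _)
      (fun a ha => List.mem_append.1 (hperm.mem_iff.2 ha)) a (hperm.mem_iff.1 (by simp))
    rw [hxp.1] at ha
    exact hm _ (visits_start _ _) ha

/-- A swap invariant function depends only on the multiset of edges of a path. -/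
theorem SwapInvariant.eq_of_perm {c₀ : V} {F : List E → X} (hF : SwapInvariant src tgt c₀ F)
    {c d : V} {α l l' : List E} (hα : IsPath src tgt c₀ α c)
    (hl : IsPath src tgt c l d) (hl' : IsPath src tgt c l' d) (hperm : l.Perm l') :
    F (α ++ l) = F (α ++ l') := by
  induction hn : l'.length generalizing c α l l' with
  | zero =>
    obtain rfl := List.eq_nil_of_length_eq_zero hn
    rw [hperm.eq_nil]
  | succ n ih =>
    obtain _ | ⟨b, p⟩ := l'
    · simp at hn
    have hbl : b ∈ l := hperm.mem_iff.2 (by simp)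
    have hn' : p.length = n := by simpa using hn
    have hαb : IsPath src tgt c₀ (α ++ [b]) (tgt b) := hα.append ⟨hl'.1, rfl⟩
    obtain ⟨x, y, rfl⟩ := List.append_of_mem hbl
    have hxy : (x ++ y).Perm p := (List.perm_middle.symm.trans hperm).cons_inv
    obtain rfl | hx := eq_or_ne x []
    · simpa using ih hαb hl.2 hl'.2 hxy hn'
    · obtain ⟨l, h₁, h₂, h₃⟩ := hF.exists_head hα hl hl' hx hxy
      rw [h₃]
      simpa using ih hαb h₁.2 hl'.2 (h₂.trans hxy) hn'

theorem exists_path_add_loop {c₀ : V} {N : ℕ} {F : List E → X} (hF : SwapInvariant src tgt c₀ F)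
    (hF' : PowInvariant src tgt c₀ N F) {d m : V} {p x : List E} (hp : IsPath src tgt c₀ p d)
    (hx : IsPath src tgt m x m) (hne : x ≠ []) (hnd : x.Nodup)
    (hbig : ∀ a ∈ x, N < Multiset.count a (p : Multiset E)) :
    ∃ q : List E, IsPath src tgt c₀ q d ∧ (q : Multiset E) = (p : Multiset E) + x ∧ F q = F p := by
  have hcx : ∀ a, Multiset.count a (x : Multiset E) ≤ 1 :=
    fun a => Multiset.nodup_iff_count_le_one.1 (by simpa using hnd) a
  have hle : N • (x : Multiset E) ≤ (p : Multiset E) := by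
    rw [Multiset.le_iff_count]
    intro a
    rw [Multiset.count_nsmul]
    by_cases ha : a ∈ x
    · nlinarith [hcx a, hbig a ha]
    · rw [Multiset.count_eq_zero_of_notMem (by simpa using ha)]; simp
  obtain ⟨M, hM⟩ := Multiset.le_iff_exists_add.1 hle
  have hbx : N • (x : Multiset E).map src = N • (x : Multiset E).map tgt := by
    rw [(Multiset.cons_inj_right m).1 hx.balance]
  have hmem : ∀ a, a ∈ M ↔ a ∈ p := by
    intro a
    have hc := congrArg (Multiset.count a) hM
    rw [Multiset.count_add, Multiset.count_nsmul] at hc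
    rw [← Multiset.mem_coe (l := p), ← Multiset.count_pos, ← Multiset.count_pos]
    by_cases ha : a ∈ x
    · have := hbig a ha
      have := Nat.mul_le_mul_left N (hcx a)
      omega
    · rw [Multiset.count_eq_zero_of_notMem (s := (x : Multiset E)) (by simpa using ha)] at hc
      simp at hc
      simp [hc]
  have hbal : d ::ₘ M.map src = c₀ ::ₘ M.map tgt := by
    have hb := hp.balance
    rw [hM, Multiset.map_add, Multiset.map_add, Multiset.map_nsmul, Multiset.map_nsmul, hbx,
      ← Multiset.add_cons, ← Multiset.add_cons] at hb
    exact add_left_cancel hb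
  obtain ⟨q, hq, rfl⟩ := hp.exists_of_balanced hmem hbal
  have hv : Visits src tgt c₀ q m := by
    obtain _ | ⟨a, x⟩ := x
    · exact absurd rfl hne
    rw [← hx.1]
    have hap : 0 < Multiset.count a (p : Multiset E) := by
      have := hbig a (by simp)
      omega
    have haq := (hmem a).2 (by simpa using Multiset.count_pos.1 hap)
    exact hq.visits_src (by simpa using haq)
  obtain ⟨q₁, q₂, rfl, h₁, h₂⟩ := hv.split hq
  have hcoe : ∀ n, ((List.replicate n x).flatten : Multiset E) = n • (x : Multiset E) := by
    intro n
    induction n with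
    | zero => simp
    | succ n ih =>
      rw [List.replicate_succ, List.flatten_cons, ← Multiset.coe_add, ih, add_comm, succ_nsmul]
  refine ⟨q₁ ++ ((List.replicate (N + 1) x).flatten ++ q₂),
    h₁.append ((hx.replicate _).append h₂), ?_, ?_⟩
  · simp only [← Multiset.coe_add, hcoe, hM, succ_nsmul]; abel
  · rw [← hF' m d q₁ x q₂ h₁ hx h₂]
    have hperm : (q₁ ++ ((List.replicate N x).flatten ++ q₂)).Perm p := by
      rw [← Multiset.coe_eq_coe, hM]
      simp only [← Multiset.coe_add, hcoe]; abel
    exact hF.eq_of_perm (α := []) rfl (h₁.append ((hx.replicate _).append h₂)) hp hperm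

theorem exists_path_add_circulation {c₀ : V} {N : ℕ} {F : List E → X}
    (hF : SwapInvariant src tgt c₀ F) (hF' : PowInvariant src tgt c₀ N F) {d : V} {p : List E}
    (hp : IsPath src tgt c₀ p d) {Z : Multiset E} (hZ : Z.map src = Z.map tgt)
    (hbig : ∀ a ∈ Z, N < Multiset.count a (p : Multiset E)) :
    ∃ q : List E, IsPath src tgt c₀ q d ∧ (q : Multiset E) = (p : Multiset E) + Z ∧ F q = F p := by
  induction hn : Z.card using Nat.strong_induction_on generalizing Z p with
  | _ n ih =>
    by_cases hZ0 : Z = 0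
    · exact ⟨p, hp, by simp [hZ0], rfl⟩
    obtain ⟨a, ha⟩ := Multiset.exists_mem_of_ne_zero hZ0
    obtain ⟨w, hw, hwp, hwZ⟩ := exists_loop_of_circulation hZ ha
    obtain ⟨x, hxn, hxw, hx0, hxp⟩ := hwp.exists_nodup_loop hw
    have hxZ : (x : Multiset E) ≤ Z := le_trans
      ((Multiset.le_iff_subset (by simpa using hxn)).2 fun b hb => hxw (by simpa using hb)) hwZ
    obtain ⟨Z', rfl⟩ := Multiset.le_iff_exists_add.1 hxZ
    obtain ⟨q, hq, hqp, hqF⟩ := exists_path_add_loop hF hF' hp hxp hx0 hxn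
      fun b hb => hbig b (Multiset.mem_add.2 (Or.inl (by simpa using hb)))
    have hZ' : Z'.map src = Z'.map tgt := by
      rw [Multiset.map_add, Multiset.map_add,
        (Multiset.cons_inj_right _).1 hxp.balance] at hZ
      exact add_left_cancel hZ
    have hpos := List.length_pos_iff.2 hx0
    obtain ⟨r, hr, hrq, hrF⟩ := ih Z'.card (by simp at hn; omega) hq hZ'
      (fun b hb => by
        have := hbig b (Multiset.mem_add.2 (Or.inr hb))
        rw [hqp, Multiset.count_add]; omega) rfl
    exact ⟨r, hr, by rw [hrq, hqp, add_assoc], hrF.trans hqF⟩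

theorem IsPath.exists_loops {a : E} {d : V} (m : ℕ) {p : List E}
    (hp : IsPath src tgt (tgt a) p d) (hm : m ≤ p.count a) :
    ∃ w : Fin m → List E, (∀ i, a ∈ w i ∧ IsPath src tgt (src a) (w i) (src a)) ∧
      ∑ i, (w i : Multiset E) ≤ ((a :: p : List E) : Multiset E) := by
  induction m generalizing p with
  | zero => exact ⟨fun _ => [], fun i => i.elim0, by simp⟩
  | succ m ih =>
    have ha : a ∈ p := List.count_pos_iff.1 (by omega)
    obtain ⟨s, t, rfl, hs⟩ := List.eq_append_cons_of_mem ha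
    obtain ⟨v, h₁, h₂⟩ := isPath_append.1 hp
    have hc : m ≤ t.count a := by
      rw [List.count_append, List.count_eq_zero_of_not_mem hs, List.count_cons_self] at hm
      omega
    obtain ⟨w, hw, hle⟩ := ih h₂.2 hc
    refine ⟨Fin.cons (a :: s) w, ?_, ?_⟩
    · intro i
      refine Fin.cases ?_ (fun j => ?_) i
      · exact ⟨by simp, rfl, h₂.1 ▸ h₁⟩
      · simpa using hw j
    · rw [Fin.sum_univ_succ]
      simp only [Fin.cons_zero, Fin.cons_succ]
      have : ((a :: (s ++ a :: t) : List E) : Multiset E)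
          = ((a :: s : List E) : Multiset E) + ((a :: t : List E) : Multiset E) := by
        rw [Multiset.coe_add]; rfl
      rw [this]
      exact add_le_add le_rfl hle

/-- An edge used very often by a path lies on a loop all of whose edges are used often. -/
theorem IsPath.exists_big_loop [Fintype E] {N : ℕ} {a : E} {c d : V} {p : List E}
    (hp : IsPath src tgt c p d)
    (ha : Fintype.card E * N + 1 < Multiset.count a (p : Multiset E)) :
    ∃ x : List E, a ∈ x ∧ IsPath src tgt (src a) x (src a) ∧
      ∀ b ∈ x, N < Multiset.count b (p : Multiset E) := by
  have hap : a ∈ p := by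
    simpa using Multiset.count_pos.1 (by omega : 0 < Multiset.count a (p : Multiset E))
  obtain ⟨s, t, rfl, hs⟩ := List.eq_append_cons_of_mem hap
  obtain ⟨v, h₁, h₂⟩ := isPath_append.1 hp
  have hc : Fintype.card E * N + 1 ≤ t.count a := by
    rw [Multiset.coe_count, List.count_append, List.count_eq_zero_of_not_mem hs,
      List.count_cons_self] at ha
    omega
  obtain ⟨w, hw, hle⟩ := h₂.2.exists_loops _ hc
  by_contra! hcon
  have hbad : ∀ i, ∃ b ∈ w i, Multiset.count b ((s ++ a :: t : List E) : Multiset E) ≤ N :=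
    fun i => hcon (w i) (hw i).1 (hw i).2
  choose b hb hbN using hbad
  obtain ⟨e, -, he⟩ := Finset.exists_lt_card_fiber_of_mul_lt_card_of_maps_to
    (s := (Finset.univ : Finset (Fin (Fintype.card E * N + 1)))) (t := (Finset.univ : Finset E))
    (f := b) (n := N) (fun _ _ => Finset.mem_univ _) (by simp)
  have hcount : (Finset.univ.filter fun i => b i = e).card ≤
      Multiset.count e ((s ++ a :: t : List E) : Multiset E) := by
    calc _ = ∑ i ∈ Finset.univ.filter (fun i => b i = e), 1 := by simp
      _ ≤ ∑ i ∈ Finset.univ.filter (fun i => b i = e), Multiset.count e (w i : Multiset E) := by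
        refine Finset.sum_le_sum fun i hi => ?_
        rw [← (Finset.mem_filter.1 hi).2]
        exact Multiset.count_pos.2 (by simpa using hb i)
      _ ≤ ∑ i, Multiset.count e (w i : Multiset E) :=
        Finset.sum_le_sum_of_subset (Finset.filter_subset _ _)
      _ = Multiset.count e (∑ i, (w i : Multiset E)) := by rw [Multiset.count_sum']
      _ ≤ Multiset.count e ((a :: t : List E) : Multiset E) := Multiset.count_le_of_le _ hle
      _ ≤ _ := by
        rw [← Multiset.coe_add, Multiset.count_add]
        exact Nat.le_add_left _ _
  obtain ⟨i, hi⟩ : (Finset.univ.filter fun i => b i = e).Nonempty :=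
    Finset.card_pos.1 (by omega)
  have := hbN i
  rw [(Finset.mem_filter.1 hi).2] at this
  omega

/-- On coterminal paths, a swap and power invariant function depends only on the numbers of
occurrences of the edges, counted up to a threshold. -/
theorem SwapInvariant.eq_of_threshold [Fintype E] {c₀ : V} {N : ℕ} {F : List E → X}
    (hF : SwapInvariant src tgt c₀ F) (hF' : PowInvariant src tgt c₀ N F) {d : V}
    {p p' : List E} (hp : IsPath src tgt c₀ p d) (hp' : IsPath src tgt c₀ p' d)
    (hcount : ∀ a : E, ∀ j ≤ (Fintype.card E + 1) * N + 2,
      (j ≤ Multiset.count a (p : Multiset E) ↔ j ≤ Multiset.count a (p' : Multiset E))) :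
    F p = F p' := by
  set l := (Fintype.card E + 1) * N + 2 with hl
  have hNl : N < l := by rw [hl, add_mul]; omega
  have hEl : Fintype.card E * N + 1 < l := by rw [hl, add_mul]; omega
  have hsmall : ∀ a, Multiset.count a (p : Multiset E) = Multiset.count a (p' : Multiset E) ∨
      (l ≤ Multiset.count a (p : Multiset E) ∧ l ≤ Multiset.count a (p' : Multiset E)) := by
    intro a
    have h₁ := hcount a l le_rfl
    by_cases h : l ≤ Multiset.count a (p : Multiset E)
    · exact Or.inr ⟨h, h₁.1 h⟩
    · have h₂ := hcount a (Multiset.count a (p : Multiset E)) (by omega)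
      have h₃ := hcount a (Multiset.count a (p' : Multiset E)) (by omega)
      left; omega
  have hloop : ∀ a, ∃ x : Multiset E, x.map src = x.map tgt ∧
      (∀ b ∈ x, N < Multiset.count b (p : Multiset E)) ∧
      (l ≤ Multiset.count a (p : Multiset E) → a ∈ x) := by
    intro a
    by_cases h : l ≤ Multiset.count a (p : Multiset E)
    · obtain ⟨x, hax, hx, hb⟩ := hp.exists_big_loop (N := N) (a := a) (by omega)
      exact ⟨x, (Multiset.cons_inj_right _).1 hx.balance, by simpa using hb,
        fun _ => by simpa using hax⟩
    · exact ⟨0, by simp, by simp, fun h' => absurd h' h⟩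
  choose x hx hxb hxa using hloop
  obtain ⟨Z, hZ, hZb, hZa⟩ : ∃ Z : Multiset E, Z.map src = Z.map tgt ∧
      (∀ b ∈ Z, N < Multiset.count b (p : Multiset E)) ∧
      (∀ a, l ≤ Multiset.count a (p : Multiset E) →
        Multiset.count a (p : Multiset E) ≤ Multiset.count a Z) := by
    refine ⟨∑ a, Multiset.count a (p : Multiset E) • x a, ?_, ?_, ?_⟩
    · have hms : ∀ f : E → V, Multiset.map f (∑ a, Multiset.count a (p : Multiset E) • x a)
          = ∑ a, Multiset.count a (p : Multiset E) • (x a).map f := by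
        intro f
        rw [← Multiset.coe_mapAddMonoidHom, map_sum]
        exact Finset.sum_congr rfl fun a _ => map_nsmul _ _ _
      rw [hms, hms]
      exact Finset.sum_congr rfl fun a _ => by rw [hx]
    · intro b hb
      obtain ⟨a, -, hba⟩ := Multiset.mem_sum.1 hb
      exact hxb a b (Multiset.mem_of_mem_nsmul hba)
    · intro a ha
      rw [Multiset.count_sum']
      refine le_trans ?_ (Finset.single_le_sum (fun _ _ => Nat.zero_le _) (Finset.mem_univ a))
      rw [Multiset.count_nsmul]
      exact Nat.le_mul_of_pos_right _ (Multiset.count_pos.2 (hxa a ha))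
  have hle : (p : Multiset E) ≤ (p' : Multiset E) + Z := by
    rw [Multiset.le_iff_count]
    intro a
    rw [Multiset.count_add]
    rcases hsmall a with h | h
    · omega
    · have := hZa a h.1; omega
  obtain ⟨Z', hZ'⟩ := Multiset.le_iff_exists_add.1 hle
  have hZ'c : Z'.map src = Z'.map tgt := by
    have h₁ := congrArg (Multiset.map src) hZ'
    have h₂ := congrArg (Multiset.map tgt) hZ'
    rw [Multiset.map_add, Multiset.map_add] at h₁ h₂
    refine add_left_cancel (a := c₀ ::ₘ (p : Multiset E).map tgt) ?_
    rw [Multiset.cons_add _ (Multiset.map tgt _) (Multiset.map tgt _), ← h₂, ← Multiset.cons_add,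
      ← hp'.balance, ← hp.balance, Multiset.cons_add, Multiset.cons_add, ← h₁, hZ]
  have hZ'b : ∀ a ∈ Z', N < Multiset.count a (p : Multiset E) := by
    intro a ha
    have h₁ := congrArg (Multiset.count a) hZ'
    rw [Multiset.count_add, Multiset.count_add] at h₁
    have h₂ := Multiset.count_pos.2 ha
    by_cases haZ : a ∈ Z
    · exact hZb a haZ
    · rw [Multiset.count_eq_zero_of_notMem haZ] at h₁
      rcases hsmall a with h | h <;> omega
  have hZb' : ∀ a ∈ Z, N < Multiset.count a (p' : Multiset E) := by
    intro a ha
    have := hZb a ha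
    rcases hsmall a with h | h <;> omega
  obtain ⟨q, hq, hqp, hqF⟩ := exists_path_add_circulation hF hF' hp hZ'c hZ'b
  obtain ⟨q', hq', hqp', hqF'⟩ := exists_path_add_circulation hF hF' hp' hZ hZb'
  rw [← hqF, ← hqF']
  refine hF.eq_of_perm (α := []) rfl hq hq' ?_
  rw [← Multiset.coe_eq_coe, hqp, hqp', hZ']

end GraphPaths

section Words

variable {Q A : Type*} {δ : Q → A → Q}

theorem deltaStar_append (q : Q) (u v : List A) :
    deltaStar δ q (u ++ v) = deltaStar δ (deltaStar δ q u) v :=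
  List.foldl_append

theorem deltaStar_nil (q : Q) : deltaStar δ q [] = q := rfl

theorem deltaStar_replicate_of_fixed {q : Q} {w : List A} (h : deltaStar δ q w = q) (n : ℕ) :
    deltaStar δ q (List.replicate n w).flatten = q := by
  induction n with
  | zero => rfl
  | succ n ih => rw [List.replicate_succ, List.flatten_cons, deltaStar_append, h, ih]

theorem CNode.exists_long {p q : Q} (h : CNode δ p q) (k : ℕ) :
    ∃ w : List A, k ≤ w.length ∧ deltaStar δ p w = p ∧ deltaStar δ q w = q := by
  obtain ⟨w, hw, hp, hq⟩ := h
  refine ⟨(List.replicate k w).flatten, ?_, deltaStar_replicate_of_fixed hp k,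
    deltaStar_replicate_of_fixed hq k⟩
  have := List.length_pos_iff.2 hw
  simp only [List.length_flatten, List.map_replicate, List.sum_replicate, smul_eq_mul]
  exact Nat.le_mul_of_pos_right _ this

theorem occCount_of_length_lt [DecidableEq A] {f w : List A} (h : w.length < f.length) :
    occCount f w = 0 := by
  have : w.length + 1 - f.length = 0 := by omega
  simp [occCount, this]

theorem occCount_cons [DecidableEq A] {f w : List A} {b : A} (h : f.length ≤ w.length + 1) :
    occCount f (b :: w) = (if (b :: w).take f.length = f then 1 else 0) + occCount f w := by
  have : (b :: w).length + 1 - f.length = (w.length + 1 - f.length) + 1 := by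
    simp only [List.length_cons]; omega
  simp only [occCount]
  rw [this, List.range_succ_eq_map, List.filter_cons, List.filter_map]
  simp only [List.drop_zero]
  split_ifs with h₁ h₂ h₂
  · simp [Function.comp_def]; omega
  · simp at h₁; exact absurd h₁ h₂
  · simp at h₁; exact absurd h₂ h₁
  · simp [Function.comp_def]

theorem occCount_append_append [DecidableEq A] {f s : List A} (h : f.length ≤ s.length + 1)
    (x y : List A) :
    occCount f (x ++ (s ++ y)) + occCount f s = occCount f (x ++ s) + occCount f (s ++ y) := by
  induction x with
  | nil => simp [add_comm]
  | cons b x ih =>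
    simp only [List.cons_append]
    rw [occCount_cons (by simp; omega), occCount_cons (by simp; omega)]
    have : (b :: (x ++ (s ++ y))).take f.length = (b :: (x ++ s)).take f.length := by
      rw [show b :: (x ++ (s ++ y)) = (b :: (x ++ s)) ++ y by simp,
        List.take_append_of_le_length (by simp; omega)]
    rw [this]
    omega

theorem occCount_le_append_left [DecidableEq A] (f x s : List A) :
    occCount f s ≤ occCount f (x ++ s) := by
  induction x with
  | nil => simp
  | cons b x ih =>
    rw [List.cons_append]
    by_cases h : f.length ≤ (x ++ s).length + 1
    · rw [occCount_cons h]; omega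
    · rw [occCount_of_length_lt (by simp at h; omega)]; omega

theorem occCount_le_append_right [DecidableEq A] (f s y : List A) :
    occCount f s ≤ occCount f (s ++ y) := by
  by_cases h : f.length ≤ s.length + 1
  · have := occCount_append_append h [] y
    induction s with
    | nil =>
      by_cases hf : f.length = 0
      · obtain rfl := List.eq_nil_of_length_eq_zero hf
        simp [occCount]
      · rw [occCount_of_length_lt (by simp; omega)]; omega
    | cons b s ih =>
      by_cases h' : f.length ≤ s.length + 1
      · rw [List.cons_append, occCount_cons h', occCount_cons (by simp; omega)]
        have hh := ih h' (by simp; omega)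
        have : (b :: (s ++ y)).take f.length = (b :: s).take f.length := by
          rw [← List.cons_append, List.take_append_of_le_length (by simp; omega)]
        rw [this]; omega
      · rw [occCount_of_length_lt (by simp; omega)]; omega
  · rw [occCount_of_length_lt (by omega)]; omega

/-- Two words which agree in all contexts as far as factors of length `k`, counted up to
threshold `l`, and borders of length `k - 1` are concerned. -/
def ThresholdCongr [DecidableEq A] (l k : ℕ) (u v : List A) : Prop :=
  u.take (k - 1) = v.take (k - 1) ∧
    u.drop (u.length - (k - 1)) = v.drop (v.length - (k - 1)) ∧
    ∀ j ≤ l, ∀ f : List A, f.length = k → (j ≤ occCount f u ↔ j ≤ occCount f v)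

theorem deltaStar_eq_of_congr [DecidableEq A] {q0 : Q} {Fset : Set Q}
    (hreach : ∀ q : Q, Reach δ q0 q)
    (hdist : ∀ p q : Q, p ≠ q →
      ∃ w : List A, ¬(deltaStar δ p w ∈ Fset ↔ deltaStar δ q w ∈ Fset)) {l k : ℕ}
    (hL : LThresholdKTestable {w : List A | w ≠ [] ∧ deltaStar δ q0 w ∈ Fset} l k)
    {u v : List A} (hu : u ≠ []) (hv : v ≠ [])
    (huv : ∀ x y, ThresholdCongr l k (x ++ (u ++ y)) (x ++ (v ++ y))) (p : Q) :
    deltaStar δ p u = deltaStar δ p v := by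
  by_contra hne
  obtain ⟨y, hy⟩ := hdist _ _ hne
  obtain ⟨x, rfl⟩ := hreach p
  obtain ⟨h₁, h₂, h₃⟩ := huv x y
  have := hL (x ++ (u ++ y)) (x ++ (v ++ y)) (by simp [hu]) (by simp [hv]) h₁ h₂ h₃
  simp only [Set.mem_ofPred_eq, deltaStar_append] at this
  simp [hu, hv] at this
  exact hy this

theorem take_drop_of_borders {k : ℕ} {e f u v : List A} (he : k ≤ e.length) (hf : k ≤ f.length) :
    (∀ x y : List A, (x ++ ((e ++ u) ++ y)).take k = (x ++ ((e ++ v) ++ y)).take k) ∧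
    (∀ x y : List A, (x ++ ((u ++ f) ++ y)).drop ((x ++ ((u ++ f) ++ y)).length - k) =
      (x ++ ((v ++ f) ++ y)).drop ((x ++ ((v ++ f) ++ y)).length - k)) := by
  constructor
  · intro x y
    have h : ∀ u, (x ++ ((e ++ u) ++ y)).take k = (x ++ e).take k := by
      intro u
      rw [show x ++ ((e ++ u) ++ y) = (x ++ e) ++ (u ++ y) by simp,
        List.take_append_of_le_length (by simp; omega)]
    rw [h, h]
  · intro x y
    have h : ∀ u, (x ++ ((u ++ f) ++ y)).drop ((x ++ ((u ++ f) ++ y)).length - k) =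
        (f ++ y).drop ((f ++ y).length - k) := by
      intro u
      have h₁ : (x ++ ((u ++ f) ++ y)).length - k = (x ++ u).length + ((f ++ y).length - k) := by
        simp; omega
      rw [h₁, show x ++ ((u ++ f) ++ y) = (x ++ u) ++ (f ++ y) by simp, List.drop_append]
      simp
    rw [h, h]

theorem swap_of_testable [DecidableEq A] {q0 : Q} {Fset : Set Q}
    (hreach : ∀ q : Q, Reach δ q0 q)
    (hdist : ∀ p q : Q, p ≠ q →
      ∃ w : List A, ¬(deltaStar δ p w ∈ Fset ↔ deltaStar δ q w ∈ Fset)) {l k : ℕ} (hk : 1 ≤ k)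
    (hL : LThresholdKTestable {w : List A | w ≠ [] ∧ deltaStar δ q0 w ∈ Fset} l k)
    (p : Q) {e f : List A} (a u b : List A) (he : k ≤ e.length) (hf : k ≤ f.length) :
    deltaStar δ (deltaStar δ (deltaStar δ (deltaStar δ (deltaStar δ (deltaStar δ
      (deltaStar δ p e) a) f) u) e) b) f =
    deltaStar δ (deltaStar δ (deltaStar δ (deltaStar δ (deltaStar δ (deltaStar δ
      (deltaStar δ p e) b) f) u) e) a) f := by
  have he0 : e ≠ [] := List.length_pos_iff.1 (by omega)
  have key : deltaStar δ p (e ++ (a ++ (f ++ (u ++ (e ++ (b ++ f)))))) =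
      deltaStar δ p (e ++ (b ++ (f ++ (u ++ (e ++ (a ++ f)))))) := by
    refine deltaStar_eq_of_congr hreach hdist hL (by simp [he0]) (by simp [he0]) ?_ p
    intro x y
    obtain ⟨h₁, -⟩ := take_drop_of_borders (k := k - 1) (e := e) (f := f)
      (u := a ++ (f ++ (u ++ (e ++ (b ++ f))))) (v := b ++ (f ++ (u ++ (e ++ (a ++ f)))))
      (by omega) (by omega)
    obtain ⟨-, h₂⟩ := take_drop_of_borders (k := k - 1) (e := e) (f := f)
      (u := e ++ (a ++ (f ++ (u ++ (e ++ b))))) (v := e ++ (b ++ (f ++ (u ++ (e ++ a)))))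
      (by omega) (by omega)
    refine ⟨h₁ x y, by simpa only [List.append_assoc] using h₂ x y, ?_⟩
    intro j _ g hg
    have hge : g.length ≤ e.length + 1 := by omega
    have hgf : g.length ≤ f.length + 1 := by omega
    have expand : ∀ a b : List A,
        occCount g (x ++ ((e ++ (a ++ (f ++ (u ++ (e ++ (b ++ f)))))) ++ y)) +
          2 * occCount g e + 2 * occCount g f =
        occCount g (x ++ e) + occCount g (e ++ (a ++ f)) + occCount g (f ++ (u ++ e)) +
          occCount g (e ++ (b ++ f)) + occCount g (f ++ y) := by
      intro a b
      have h₁ := occCount_append_append hge x (a ++ (f ++ (u ++ (e ++ (b ++ (f ++ y))))))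
      have h₂ := occCount_append_append hgf (e ++ a) (u ++ (e ++ (b ++ (f ++ y))))
      have h₃ := occCount_append_append hge (f ++ u) (b ++ (f ++ y))
      have h₄ := occCount_append_append hgf (e ++ b) y
      simp only [List.append_assoc] at h₁ h₂ h₃ h₄ ⊢
      omega
    have h₁ := expand a b
    have h₂ := expand b a
    omega
  simpa only [deltaStar_append] using key

theorem aperiodic_of_testable [DecidableEq A] {q0 : Q} {Fset : Set Q}
    (hreach : ∀ q : Q, Reach δ q0 q)
    (hdist : ∀ p q : Q, p ≠ q →
      ∃ w : List A, ¬(deltaStar δ p w ∈ Fset ↔ deltaStar δ q w ∈ Fset)) {l k : ℕ} (hk : 1 ≤ k)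
    (hL : LThresholdKTestable {w : List A | w ≠ [] ∧ deltaStar δ q0 w ∈ Fset} l k)
    {p : Q} {e a b : List A} (he : k ≤ e.length) (hp : deltaStar δ p e = p)
    (hq : deltaStar δ (deltaStar δ p a) e = deltaStar δ p a)
    (hab : deltaStar δ (deltaStar δ p a) b = p) : deltaStar δ p a = p := by
  have he0 : e ≠ [] := List.length_pos_iff.1 (by omega)
  set P : ℕ → List A := fun n => (List.replicate n (e ++ (a ++ (e ++ b)))).flatten with hP
  have hPfix : ∀ n, deltaStar δ p (P n) = p := by
    intro n
    exact deltaStar_replicate_of_fixed (by simp only [deltaStar_append, hp, hq, hab]) n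
  have hPs : ∀ n, P (n + 1) = e ++ (a ++ (e ++ (b ++ P n))) := by
    intro n; simp [hP, List.replicate_succ]
  have hPe : ∀ n, ∃ t, P n ++ e = e ++ t := by
    intro n
    cases n with
    | zero => exact ⟨[], by simp [hP]⟩
    | succ n => exact ⟨a ++ (e ++ (b ++ P n)) ++ e, by simp [hPs]⟩
  have hcount : ∀ g : List A, g.length = k → occCount g e < occCount g (e ++ (a ++ e)) →
      ∀ n, n ≤ occCount g (P n ++ e) := by
    intro g hg hlt n
    have hge : g.length ≤ e.length + 1 := by omega
    induction n with
    | zero => omega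
    | succ n ih =>
      obtain ⟨t, ht⟩ := hPe n
      have h₁ := occCount_append_append hge (e ++ a) (b ++ (e ++ t))
      have h₂ := occCount_append_append hge (e ++ b) t
      have h₃ := occCount_le_append_left g (e ++ b) e
      rw [hPs]
      rw [ht] at ih
      simp only [List.append_assoc, ht] at h₁ h₂ h₃ ⊢
      omega
  have key : deltaStar δ p (P l ++ e) = deltaStar δ p (P l ++ (e ++ (a ++ e))) := by
    refine deltaStar_eq_of_congr hreach hdist hL (by simp [he0]) (by simp [he0]) ?_ p
    intro x y
    obtain ⟨t, ht⟩ := hPe l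
    have h₁ := (take_drop_of_borders (k := k - 1) (e := e) (f := e)
      (u := t) (v := t ++ (a ++ e)) (by omega) (by omega)).1
    have h₂ := (take_drop_of_borders (k := k - 1) (e := e) (f := e)
      (u := P l) (v := P l ++ (e ++ a)) (by omega) (by omega)).2
    refine ⟨?_, by simpa only [List.append_assoc] using h₂ x y, ?_⟩
    · rw [show P l ++ (e ++ (a ++ e)) = e ++ (t ++ (a ++ e)) by
        rw [← List.append_assoc, ht, List.append_assoc], ht]
      exact h₁ x y
    intro j hj g hg
    have hge : g.length ≤ e.length + 1 := by omega
    have h₃ := occCount_append_append hge (x ++ P l) y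
    have h₄ := occCount_append_append hge (x ++ P l) (a ++ (e ++ y))
    have h₅ := occCount_append_append hge (e ++ a) y
    have h₆ := occCount_le_append_left g (e ++ a) e
    have h₇ := occCount_le_append_left g x (P l ++ e)
    have h₈ := occCount_le_append_right g (x ++ (P l ++ e)) y
    simp only [List.append_assoc] at h₃ h₄ h₅ h₆ h₇ h₈ ⊢
    by_cases hlt : occCount g e < occCount g (e ++ (a ++ e))
    · have := hcount g hg hlt l
      omega
    · omega
  simp only [deltaStar_append, hPfix, hp, hq] at key
  exact key.symm

end Words

section StablePositions

variable {Q A : Type*} {δ : Q → A → Q}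

/-- The transformation induced by `t` is fixed on the right by some nonempty word. -/
def RightStable (δ : Q → A → Q) (t : List A) : Prop :=
  ∃ e : List A, e ≠ [] ∧ ∀ p, deltaStar δ (deltaStar δ p t) e = deltaStar δ p t

theorem RightStable.append_left {t : List A} (h : RightStable δ t) (s : List A) :
    RightStable δ (s ++ t) := by
  obtain ⟨e, he, h⟩ := h
  exact ⟨e, he, fun p => by rw [deltaStar_append, h]⟩

theorem exists_rightStable_take [Finite Q] (δ : Q → A → Q) {c : List A}
    (hc : Nat.card (Q → Q) < c.length) :
    ∃ i < c.length, RightStable δ (c.take i) := by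
  have hex : ∃ i j : ℕ, i < j ∧ j < c.length ∧
      ∀ p, deltaStar δ p (c.take i) = deltaStar δ p (c.take j) := by
    by_contra! hcon
    have hinj : Function.Injective
        (fun (i : Fin c.length) (p : Q) => deltaStar δ p (c.take i)) := by
      intro i j h
      by_contra hne
      rcases Nat.lt_or_gt_of_ne (fun h => hne (Fin.ext h)) with hlt | hlt
      · obtain ⟨p, hp⟩ := hcon i j hlt j.2
        exact hp (congrFun h p)
      · obtain ⟨p, hp⟩ := hcon j i hlt i.2
        exact hp (congrFun h p).symm
    have := Nat.card_le_card_of_injective _ hinj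
    simp only [Nat.card_eq_fintype_card, Fintype.card_fin] at this
    omega
  obtain ⟨i, j, hij, hj, h⟩ := hex
  refine ⟨i, by omega, (c.take j).drop i, ?_, fun p => ?_⟩
  · refine List.length_pos_iff.1 ?_
    simp; omega
  · rw [← deltaStar_append]
    have : c.take i ++ (c.take j).drop i = c.take j := by
      have h := List.take_append_drop i (c.take j)
      rwa [List.take_take, Nat.min_eq_left hij.le] at h
    rw [this, h]

/-- A shift compatible choice of a right stable prefix in all words of some fixed length. -/
theorem exists_stable_position [Finite Q] (δ : Q → A → Q) :
    ∃ (n : ℕ) (pos : List A → ℕ), ∀ c : List A, c.length = n →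
      pos c ≤ n ∧ RightStable δ (c.take (pos c)) ∧
      ∀ W X d : List A, c ++ X = W ++ d → d.length = n → pos c ≤ W.length + pos d := by
  classical
  set N := Nat.card (Q → Q) + 1 with hN
  let G : List A → ℕ → Prop := fun c i => N ≤ i ∧ i ≤ c.length ∧
    RightStable δ ((c.take i).drop (i - N))
  let pos : List A → ℕ := fun c => Nat.findGreatest (G c) c.length
  have hG : ∀ c : List A, c.length = 2 * N → G c (pos c) := by
    intro c hc
    obtain ⟨i, hi, hs⟩ := exists_rightStable_take δ (c := c.drop N) (by simp; omega)
    have hi' : i < N := by simp at hi; omega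
    refine Nat.findGreatest_spec (P := G c) (m := N + i) (by omega) ⟨by omega, by omega, ?_⟩
    have : (c.take (N + i)).drop (N + i - N) = (c.drop i).take (N - i) ++ (c.drop N).take i := by
      rw [List.drop_take, show N + i - (N + i - N) = (N - i) + i by omega,
        show N + i - N = i by omega, List.take_add, List.drop_drop,
        show i + (N - i) = N by omega]
    rw [this]
    exact hs.append_left _
  refine ⟨2 * N, pos, fun c hc => ?_⟩
  obtain ⟨h₁, h₂, h₃⟩ := hG c hc
  refine ⟨by omega, ?_, ?_⟩
  · have := h₃.append_left (c.take (pos c - N))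
    have h := List.take_append_drop (pos c - N) (c.take (pos c))
    rw [List.take_take, Nat.min_eq_left (by omega)] at h
    rwa [h] at this
  · intro W X d hWX hd
    obtain ⟨h₁', -, -⟩ := hG d hd
    by_cases hlt : pos c < W.length + N
    · omega
    have hle : pos c - W.length ≤ pos d := by
      refine Nat.le_findGreatest (by omega) ⟨by omega, by omega, ?_⟩
      have ht : c.take (pos c) = W ++ d.take (pos c - W.length) := by
        have h := congrArg (List.take (pos c)) hWX
        rw [List.take_append_of_le_length h₂, List.take_append,
          List.take_of_length_le (l := W) (by omega)] at h
        exact h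
      rw [ht, List.drop_append, List.drop_of_length_le (by omega), List.nil_append] at h₃
      rwa [show pos c - W.length - N = pos c - N - W.length by omega]
    omega

theorem exists_shifted_suffix {c₁ c₂ d₁ d₂ X W : List A}
    (h : (c₁ ++ c₂) ++ X = W ++ (d₁ ++ d₂)) (hle : c₁.length ≤ W.length + d₁.length) :
    ∃ X', c₂ ++ X = X' ++ d₂ ∧ c₁ ++ X' = W ++ d₁ := by
  rw [List.append_assoc, ← List.append_assoc W] at h
  obtain ⟨X', h₁, h₂⟩ | ⟨X', h₁, h₂⟩ := List.append_eq_append_iff.1 h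
  · exact ⟨X', h₂, h₁.symm⟩
  · have hl := congrArg List.length h₁
    simp only [List.length_append] at hl
    obtain rfl : X' = [] := List.eq_nil_of_length_eq_zero (by omega)
    exact ⟨[], by simpa using h₂.symm, by simpa using h₁⟩

end StablePositions

section Conditions

variable {Q A : Type*} {δ : Q → A → Q}

/-- Two states of the same strongly connected component forming a C-node are equal. -/
def CNodeSeparated (δ : Q → A → Q) : Prop :=
  ∀ p q : Q, CNode δ p q → Reach δ p q → Reach δ q p → p = q

/-- If `e` fixes `p`, `q₁`, `r₁` and `f` fixes `q`, `r`, `t`, `t'`, where `x`, `y`, `z` lead from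
`p` to `q`, `q₁`, `t'` and `z`, `y`, `x` lead from `p` to `r`, `r₁`, `t`, then `t` and `t'` are equal. -/
def StateSwap (δ : Q → A → Q) : Prop :=
  ∀ (e f x y z : List A) (p q r q₁ r₁ t t' : Q), e ≠ [] → f ≠ [] →
    deltaStar δ p e = p → deltaStar δ q₁ e = q₁ → deltaStar δ r₁ e = r₁ →
    deltaStar δ q f = q → deltaStar δ r f = r → deltaStar δ t f = t → deltaStar δ t' f = t' →
    deltaStar δ p x = q → deltaStar δ q y = q₁ → deltaStar δ q₁ z = t' →
    deltaStar δ p z = r → deltaStar δ r y = r₁ → deltaStar δ r₁ x = t → t = t'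

theorem stateSwap_of_conditions (h₁ : CNodeSeparated δ)
    (h₂ : ∀ p q t r₁ : Q, CNode δ p r₁ →
      (∃ w : List A, deltaStar δ p w = q ∧ deltaStar δ r₁ w = t) →
      (∃ r : Q, Reach δ p r ∧ Reach δ r r₁ ∧ CNode δ r t) → Reach δ q t)
    (h₄ : ∀ p q r q₁ r₁ : Q, CNode δ p q₁ → CNode δ q r → Reach δ p q → Reach δ p r →
      (∃ w : List A, deltaStar δ q w = q₁ ∧ deltaStar δ r w = r₁) → CNode δ p r₁ →
      ∀ t ∈ TSet δ p q r₁, ∀ t' ∈ TSet δ p r q₁, Reach δ t t' ∧ Reach δ t' t) :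
    StateSwap δ := by
  intro e f x y z p q r q₁ r₁ t t' he hf hp hq₁ hr₁ hq hr ht ht' hpx hqy hq₁z hpz hry hr₁x
  have hqt : Reach δ q t := h₂ p q t r₁ ⟨e, he, hp, hr₁⟩ ⟨x, hpx, hr₁x⟩
    ⟨r, ⟨z, hpz⟩, ⟨y, hry⟩, ⟨f, hf, hr, ht⟩⟩
  have hrt' : Reach δ r t' := h₂ p r t' q₁ ⟨e, he, hp, hq₁⟩ ⟨z, hpz, hq₁z⟩
    ⟨q, ⟨x, hpx⟩, ⟨y, hqy⟩, ⟨f, hf, hq, ht'⟩⟩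
  obtain ⟨htt', ht't⟩ := h₄ p q r q₁ r₁ ⟨e, he, hp, hq₁⟩ ⟨f, hf, hq, hr⟩ ⟨x, hpx⟩ ⟨z, hpz⟩
    ⟨y, hqy, hry⟩ ⟨e, he, hp, hr₁⟩ t ⟨⟨x, hpx, hr₁x⟩, hqt, f, hf, hq, ht⟩
    t' ⟨⟨z, hpz, hq₁z⟩, hrt', f, hf, hr, ht'⟩
  exact h₁ t t' ⟨f, hf, ht, ht'⟩ htt' ht't

/-- If all iterates of `x` on `p` are fixed by `e`, then the orbit of `p` under `x` stabilizes. -/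
theorem CNodeSeparated.replicate_eq [Finite Q] (h : CNodeSeparated δ) {p : Q} {e x : List A}
    (he : e ≠ [])
    (hfix : ∀ i, deltaStar δ (deltaStar δ p (List.replicate i x).flatten) e =
      deltaStar δ p (List.replicate i x).flatten) :
    deltaStar δ p (List.replicate (Nat.card Q) x).flatten =
      deltaStar δ p (List.replicate (Nat.card Q + 1) x).flatten := by
  set s : ℕ → Q := fun i => deltaStar δ p (List.replicate i x).flatten with hs
  have hadd : ∀ i j, s (i + j) = deltaStar δ (s i) (List.replicate j x).flatten := by
    intro i j
    simp only [hs]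
    rw [List.replicate_add, List.flatten_append, deltaStar_append]
  have hstab : ∀ i j, s i = s (i + 1) → s (i + j) = s i := by
    intro i j hi
    rw [hadd]
    refine deltaStar_replicate_of_fixed ?_ j
    have := hadd i 1
    simpa [← hi] using this.symm
  obtain ⟨i, j, hij, hj, heq⟩ : ∃ i j, i < j ∧ j ≤ Nat.card Q ∧ s i = s j := by
    by_contra! hcon
    have hinj : Function.Injective (fun i : Fin (Nat.card Q + 1) => s i) := by
      intro i j hij
      by_contra hne
      rcases Nat.lt_or_gt_of_ne (fun h => hne (Fin.ext h)) with hlt | hlt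
      · exact hcon i j hlt (Nat.lt_succ_iff.1 j.2) hij
      · exact hcon j i hlt (Nat.lt_succ_iff.1 i.2) hij.symm
    have := Nat.card_le_card_of_injective _ hinj
    simp only [Nat.card_eq_fintype_card, Fintype.card_fin] at this
    omega
  have hi : s i = s (i + 1) := by
    refine h _ _ ⟨e, he, hfix i, hfix (i + 1)⟩ ⟨_, (hadd i 1).symm⟩
      ⟨(List.replicate (j - (i + 1)) x).flatten, ?_⟩
    rw [← hadd, heq]
    congr 1; omega
  have e₁ := hstab i (Nat.card Q - i) hi
  have e₂ := hstab i (Nat.card Q + 1 - i) hi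
  rw [show i + (Nat.card Q - i) = Nat.card Q by omega] at e₁
  rw [show i + (Nat.card Q + 1 - i) = Nat.card Q + 1 by omega] at e₂
  exact e₁.trans e₂.symm

end Conditions

section Windows

variable {A : Type*} {n : ℕ}

/-- The target of an edge of the de Bruijn graph: append a letter and drop the first one. -/
def windowShift (e : List.Vector A n × A) : List.Vector A n :=
  ⟨(e.1.1 ++ [e.2]).drop 1, by simp⟩

/-- The path of the de Bruijn graph which starts at a window and reads a word. -/
def windowPath : List.Vector A n → List A → List (List.Vector A n × A)
  | _, [] => []
  | c, a :: X => (c, a) :: windowPath (windowShift (c, a)) X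

theorem windowShift_spec (c : List.Vector A n) (a : A) :
    ∃ b, c.1 ++ [a] = b :: (windowShift (c, a)).1 := by
  obtain ⟨b, t, h⟩ := List.exists_cons_of_ne_nil (l := c.1 ++ [a]) (by simp)
  exact ⟨b, by simp [windowShift, h]⟩

theorem map_snd_windowPath (c : List.Vector A n) (X : List A) :
    (windowPath c X).map Prod.snd = X := by
  induction X generalizing c with
  | nil => rfl
  | cons a X ih => simp [windowPath, ih]

theorem isPath_windowPath (c : List.Vector A n) (X : List A) :
    ∃ d : List.Vector A n, IsPath Prod.fst windowShift c (windowPath c X) d ∧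
      d.1 = (c.1 ++ X).drop X.length := by
  induction X generalizing c with
  | nil => exact ⟨c, rfl, by simp⟩
  | cons a X ih =>
    obtain ⟨d, hd, h⟩ := ih (windowShift (c, a))
    obtain ⟨b, hb⟩ := windowShift_spec c a
    refine ⟨d, ⟨rfl, hd⟩, ?_⟩
    rw [h, show c.1 ++ a :: X = (c.1 ++ [a]) ++ X by simp, hb]
    simp

theorem IsPath.exists_eq_append {c d : List.Vector A n} {l : List (List.Vector A n × A)}
    (h : IsPath Prod.fst windowShift c l d) :
    ∃ W, c.1 ++ l.map Prod.snd = W ++ d.1 := by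
  induction l generalizing c with
  | nil => obtain rfl : c = d := h; exact ⟨[], by simp⟩
  | cons e l ih =>
    obtain ⟨W, hW⟩ := ih h.2
    obtain ⟨c', a⟩ := e
    obtain rfl : c' = c := h.1
    obtain ⟨b, hb⟩ := windowShift_spec c' a
    refine ⟨b :: W, ?_⟩
    rw [List.map_cons, show c'.1 ++ a :: l.map Prod.snd = (c'.1 ++ [a]) ++ l.map Prod.snd by simp,
      hb,
      List.cons_append, hW, List.cons_append]

theorem count_windowPath [DecidableEq A] [BEq (List.Vector A n × A)]
    [LawfulBEq (List.Vector A n × A)]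
    (e : List.Vector A n × A) (c : List.Vector A n) (X : List A) :
    (windowPath c X).count e = occCount (e.1.1 ++ [e.2]) (c.1 ++ X) := by
  have hel : (e.1.1 ++ [e.2]).length = n + 1 := by simp
  induction X generalizing c with
  | nil => rw [occCount_of_length_lt (by simp)]; simp [windowPath]
  | cons a X ih =>
    obtain ⟨b, hb⟩ := windowShift_spec c a
    rw [windowPath, List.count_cons, ih, show c.1 ++ a :: X = (c.1 ++ [a]) ++ X by simp, hb,
      List.cons_append, occCount_cons (by simp), add_comm, hel]
    have ht : (b :: ((windowShift (c, a)).1 ++ X)).take (n + 1) = c.1 ++ [a] := by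
      rw [hb, ← List.cons_append, List.take_append_of_le_length (by simp),
        List.take_of_length_le (by simp)]
    rw [ht]
    congr 1
    have : ((c, a) == e) = true ↔ c.1 ++ [a] = e.1.1 ++ [e.2] := by
      rw [beq_iff_eq]
      constructor
      · rintro rfl; rfl
      · intro h
        obtain ⟨h₁, h₂⟩ := List.append_inj' h rfl
        exact Prod.ext (Subtype.ext h₁) (by simpa using h₂)
    simp only [this]

end Windows

section Main

variable {Q A : Type*} {δ : Q → A → Q}

/-- The function sending a path of the de Bruijn graph to the state reached along it. -/
def windowState (δ : Q → A → Q) {n : ℕ} (p : Q) (l : List (List.Vector A n × A)) : Q :=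
  deltaStar δ p (l.map Prod.snd)

theorem exists_window_invariants [Finite Q] (h₁ : CNodeSeparated δ) (h₂ : StateSwap δ) :
    ∃ n : ℕ, ∀ (q0 : Q) (c₀ : List.Vector A n),
      SwapInvariant Prod.fst windowShift c₀ (windowState δ (deltaStar δ q0 c₀.1)) ∧
      PowInvariant Prod.fst windowShift c₀ (Nat.card Q) (windowState δ (deltaStar δ q0 c₀.1)) := by
  obtain ⟨n, pos, hpos⟩ := exists_stable_position δ
  refine ⟨n, fun q0 c₀ => ⟨?_, ?_⟩⟩
  · intro c d g α x y z β hα hx hy hz _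
    obtain ⟨W₀, hW₀⟩ := hα.exists_eq_append
    obtain ⟨W₁, hW₁⟩ := hx.exists_eq_append
    obtain ⟨W₂, hW₂⟩ := hy.exists_eq_append
    obtain ⟨W₃, hW₃⟩ := hz.exists_eq_append
    obtain ⟨-, ⟨e, he, hes⟩, hce⟩ := hpos c.1 c.2
    obtain ⟨-, ⟨f, hf, hfs⟩, hdf⟩ := hpos d.1 d.2
    have hcl : (c.1.take (pos c.1)).length = pos c.1 := by
      simpa using (hpos c.1 c.2).1
    have hdl : (d.1.take (pos d.1)).length = pos d.1 := by
      simpa using (hpos d.1 d.2).1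
    have hxle := hce _ _ _ hW₁ d.2
    have hyle := hdf _ _ _ hW₂ c.2
    have hzle := hce _ _ _ hW₃ d.2
    rw [← hcl, ← hdl] at hxle hyle hzle
    obtain ⟨c₁, c₂, hc₁, hc⟩ : ∃ c₁ c₂, c.1.take (pos c.1) = c₁ ∧ c.1 = c₁ ++ c₂ :=
      ⟨_, _, rfl, (List.take_append_drop _ _).symm⟩
    obtain ⟨d₁, d₂, hd₁, hd⟩ : ∃ d₁ d₂, d.1.take (pos d.1) = d₁ ∧ d.1 = d₁ ++ d₂ :=
      ⟨_, _, rfl, (List.take_append_drop _ _).symm⟩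
    rw [hc₁] at hes hxle hyle hzle
    rw [hd₁] at hfs hxle hyle hzle
    rw [hc] at hW₀
    rw [hc, hd] at hW₁ hW₂ hW₃
    obtain ⟨X, hX, hX'⟩ := exists_shifted_suffix hW₁ hxle
    obtain ⟨Y, hY, hY'⟩ := exists_shifted_suffix hW₂ hyle
    obtain ⟨Z, hZ, hZ'⟩ := exists_shifted_suffix hW₃ hzle
    have split : ∀ (p : Q) {u v u' v' : List A}, u ++ v = u' ++ v' →
        deltaStar δ (deltaStar δ p u) v = deltaStar δ (deltaStar δ p u') v' := by
      intro p u v u' v' h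
      rw [← deltaStar_append, h, deltaStar_append]
    set p := deltaStar δ (deltaStar δ q0 W₀) c₁ with hp
    have hfX : ∀ s, deltaStar δ (deltaStar δ (deltaStar δ s c₁) X) f =
        deltaStar δ (deltaStar δ s c₁) X := fun s => by rw [split s hX', hfs]
    have hfZ : ∀ s, deltaStar δ (deltaStar δ (deltaStar δ s c₁) Z) f =
        deltaStar δ (deltaStar δ s c₁) Z := fun s => by rw [split s hZ', hfs]
    have hXY : deltaStar δ (deltaStar δ p X) Y =
        deltaStar δ (deltaStar δ (deltaStar δ (deltaStar δ q0 W₀) W₁) W₂) c₁ := by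
      rw [hp, split _ hX', split _ hY']
    have hZY : deltaStar δ (deltaStar δ p Z) Y =
        deltaStar δ (deltaStar δ (deltaStar δ (deltaStar δ q0 W₀) W₃) W₂) c₁ := by
      rw [hp, split _ hZ', split _ hY']
    have key := h₂ e f X Y Z p _ _ _ _ _ _ he hf (hes _) (by rw [hXY, hes]) (by rw [hZY, hes])
      (hfX _) (hfZ _) (by rw [hZY, hfX]) (by rw [hXY, hfZ]) rfl rfl rfl rfl rfl rfl
    simp only [windowState, List.map_append]
    simp only [deltaStar_append]
    have start : deltaStar δ (deltaStar δ (deltaStar δ q0 c₀.1) (α.map Prod.snd)) =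
        deltaStar δ (deltaStar δ p c₂) := by
      rw [← deltaStar_append, hW₀, deltaStar_append, deltaStar_append]
    rw [start, split _ hX, split _ hY, split _ hZ, split _ hZ, split _ hY, split _ hX, key]
  · intro c g α x β hα hx _
    obtain ⟨W₀, hW₀⟩ := hα.exists_eq_append
    obtain ⟨W₁, hW₁⟩ := hx.exists_eq_append
    obtain ⟨-, ⟨e, he, hes⟩, hce⟩ := hpos c.1 c.2
    have hcl : (c.1.take (pos c.1)).length = pos c.1 := by
      simpa using (hpos c.1 c.2).1
    have hxle := hce _ _ _ hW₁ c.2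
    rw [← hcl] at hxle
    obtain ⟨c₁, c₂, hc₁, hc⟩ : ∃ c₁ c₂, c.1.take (pos c.1) = c₁ ∧ c.1 = c₁ ++ c₂ :=
      ⟨_, _, rfl, (List.take_append_drop _ _).symm⟩
    rw [hc₁] at hes hxle
    rw [hc] at hW₀ hW₁
    obtain ⟨X, hX, hX'⟩ := exists_shifted_suffix hW₁ hxle
    have hpow : ∀ i, c₂ ++ ((List.replicate i x).flatten).map Prod.snd =
        (List.replicate i X).flatten ++ c₂ := by
      intro i
      induction i with
      | zero => simp
      | succ i ih =>
        rw [List.replicate_succ, List.replicate_succ, List.flatten_cons, List.flatten_cons,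
          List.map_append, ← List.append_assoc, hX, List.append_assoc, ih, List.append_assoc]
    have hpow' : ∀ i, ∃ W, c₁ ++ (List.replicate i X).flatten = W ++ c₁ := by
      intro i
      induction i with
      | zero => exact ⟨[], by simp⟩
      | succ i ih =>
        obtain ⟨W, hW⟩ := ih
        refine ⟨W₁ ++ W, ?_⟩
        rw [List.replicate_succ, List.flatten_cons, ← List.append_assoc, hX', List.append_assoc, hW,
          List.append_assoc]
    have key := h₁.replicate_eq (p := deltaStar δ (deltaStar δ q0 W₀) c₁) (x := X) he (by
      intro i
      obtain ⟨W, hW⟩ := hpow' i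
      rw [← deltaStar_append (deltaStar δ q0 W₀), hW, deltaStar_append, hes])
    have expand : ∀ i,
        windowState δ (deltaStar δ q0 c₀.1) (α ++ ((List.replicate i x).flatten ++ β))
        = deltaStar δ (deltaStar δ (deltaStar δ (deltaStar δ (deltaStar δ q0 W₀) c₁)
          (List.replicate i X).flatten) c₂) (β.map Prod.snd) := by
      intro i
      rw [windowState, List.map_append, List.map_append]
      simp only [← deltaStar_append]
      rw [← List.append_assoc c₀.1, hW₀]
      congr 1
      simp only [List.append_assoc]
      rw [← List.append_assoc c₂, hpow, List.append_assoc]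
    rw [expand, expand, key]

theorem locallyThresholdTestable_of_invariants [Finite Q] [Finite A] [DecidableEq A]
    (h₁ : CNodeSeparated δ) (h₂ : StateSwap δ) (q0 : Q) (Fset : Set Q) :
    LocallyThresholdTestable {w : List A | w ≠ [] ∧ deltaStar δ q0 w ∈ Fset} := by
  classical
  have := Fintype.ofFinite A
  obtain ⟨n, hn⟩ := exists_window_invariants h₁ h₂
  refine ⟨n + 1, by omega, (Fintype.card (List.Vector A n × A) + 1) * Nat.card Q + 2, by omega, ?_⟩
  intro u v hu hv htake hdrop hocc
  suffices h : deltaStar δ q0 u = deltaStar δ q0 v by simp [hu, hv, h]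
  rw [Nat.add_sub_cancel] at htake hdrop
  have hlen := congrArg List.length htake
  rw [List.length_take, List.length_take] at hlen
  by_cases hun : u.length < n
  · rw [List.take_of_length_le (by omega), List.take_of_length_le (by omega)] at htake
    rw [htake]
  let c : List.Vector A n := ⟨u.take n, by simp; omega⟩
  have hcu : c.1 ++ u.drop n = u := List.take_append_drop _ _
  have hcv : c.1 ++ v.drop n = v := by
    change u.take n ++ v.drop n = v
    rw [htake, List.take_append_drop]
  obtain ⟨d, hd, hdu⟩ := isPath_windowPath c (u.drop n)
  obtain ⟨d', hd', hdv⟩ := isPath_windowPath c (v.drop n)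
  obtain rfl : d = d' := by
    refine Subtype.ext ?_
    rw [hdu, hdv, hcu, hcv, List.length_drop, List.length_drop, hdrop]
  obtain ⟨hs, hp⟩ := hn q0 c
  have key := hs.eq_of_threshold hp hd hd' (by
    intro e j hj
    let inst : DecidableEq (List.Vector A n × A) := fun a b => Classical.propDecidable (a = b)
    have hcount (X : List A) : @Multiset.count _ inst e (windowPath c X) =
        occCount (e.1.1 ++ [e.2]) (c.1 ++ X) :=
      (@Multiset.coe_count _ inst _ _).trans (@count_windowPath _ _ _ (@instBEqOfDecidableEq _ inst)
        (@instLawfulBEq _ inst) e c X)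
    have := hocc j hj (e.1.1 ++ [e.2]) (by simp)
    rw [← hcu, ← hcv, ← hcount, ← hcount] at this
    exact this)
  rwa [windowState, windowState, map_snd_windowPath, map_snd_windowPath, ← deltaStar_append,
    ← deltaStar_append, hcu, hcv] at key

end Main

/-- Trahtman's criterion for local threshold testability of a reduced complete
DFA in terms of its transition graph: conditions (1)–(4) on C-nodes, reachability
and the sets `T(p,q,r₁)` (condition (3) says each `T(p,q,r₁)` lies in a single
strongly connected component, so `T3_SCC(p,q,r₁)` is well defined; condition (4)
says `T3_SCC(p,q,r₁) = T3_SCC(p,r,q₁)`). -/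
theorem locally_threshold_testable_iff_graph_conditions
    {Q A : Type*} [Fintype Q] [Fintype A] [DecidableEq A]
    (δ : Q → A → Q) (q0 : Q) (Fset : Set Q)
    (hreach : ∀ q : Q, Reach δ q0 q)
    (hdist : ∀ p q : Q, p ≠ q →
      ∃ w : List A, ¬(deltaStar δ p w ∈ Fset ↔ deltaStar δ q w ∈ Fset)) :
    LocallyThresholdTestable {w : List A | w ≠ [] ∧ deltaStar δ q0 w ∈ Fset} ↔
      ((∀ p q : Q, CNode δ p q → Reach δ p q → Reach δ q p → p = q) ∧
       (∀ p q t r₁ : Q, CNode δ p r₁ →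
          (∃ w : List A, deltaStar δ p w = q ∧ deltaStar δ r₁ w = t) →
          (∃ r : Q, Reach δ p r ∧ Reach δ r r₁ ∧ CNode δ r t) →
          Reach δ q t) ∧
       (∀ p q r₁ : Q, CNode δ p r₁ → Reach δ p q →
          (∃ r : Q, CNode δ q r ∧ Reach δ p r ∧ Reach δ r r₁) →
          ∀ t ∈ TSet δ p q r₁, ∀ t' ∈ TSet δ p q r₁,
            Reach δ t t' ∧ Reach δ t' t) ∧
       (∀ p q r q₁ r₁ : Q, CNode δ p q₁ → CNode δ q r →
          Reach δ p q → Reach δ p r →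
          (∃ w : List A, deltaStar δ q w = q₁ ∧ deltaStar δ r w = r₁) →
          CNode δ p r₁ →
          ∀ t ∈ TSet δ p q r₁, ∀ t' ∈ TSet δ p r q₁,
            Reach δ t t' ∧ Reach δ t' t)) := by
  classical
  constructor
  · rintro ⟨k, hk, l, -, hL⟩
    have swap : ∀ (p : Q) {e f : List A} (a u b : List A), k ≤ e.length → k ≤ f.length → _ :=
      fun p _ _ a u b he hf => swap_of_testable hreach hdist hk hL p a u b he hf
    refine ⟨?_, ?_, ?_, ?_⟩
    · rintro p q hC ⟨a, rfl⟩ ⟨b, hb⟩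
      obtain ⟨e, he, hp, hq⟩ := hC.exists_long k
      exact (aperiodic_of_testable hreach hdist hk hL he hp hq hb).symm
    · rintro p q t r₁ hC ⟨w, hw, hw'⟩ ⟨r, ⟨b, hb⟩, ⟨u, hu⟩, hC'⟩
      obtain ⟨e, he, hp, hr₁⟩ := hC.exists_long k
      obtain ⟨f, hf, hr, ht⟩ := hC'.exists_long k
      have h := swap p w u b he hf
      simp only [hp, hw, hb, hr, hu, hr₁, hw', ht] at h
      exact ⟨f ++ (u ++ (e ++ (b ++ f))), by simpa only [deltaStar_append] using h⟩
    · have half : ∀ (p q r₁ : Q), CNode δ p r₁ →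
          (∃ r : Q, CNode δ q r ∧ Reach δ p r ∧ Reach δ r r₁) →
          ∀ t ∈ TSet δ p q r₁, ∀ t' ∈ TSet δ p q r₁, Reach δ t t' := by
        rintro p q r₁ hC ⟨r, hqr, ⟨b, hb⟩, ⟨u, hu⟩⟩ t ⟨⟨w, hw, hw'⟩, -, -⟩
          t' ⟨⟨x, hx, hx'⟩, ⟨v, hv⟩, hC'⟩
        obtain ⟨e, he, hp, hr₁⟩ := hC.exists_long k
        obtain ⟨g, hg, hq, hr⟩ := hqr.exists_long k
        obtain ⟨f, hf, hqf, ht'⟩ := hC'.exists_long k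
        have h₁ := swap p w u b he hg
        have h₂ := swap p x u b he hg
        have h₃ := swap q g [] v hf hf
        simp only [hp, hw, hx, hb, hq, hr, hu, hr₁, hw', hx'] at h₁ h₂
        simp only [hq, hqf, hv, ht', deltaStar_nil] at h₃
        exact ⟨g ++ f, by rw [deltaStar_append, ← h₁, h₂, ← h₃]⟩
      intro p q r₁ hC _ hr t ht t' ht'
      exact ⟨half p q r₁ hC hr t ht t' ht', half p q r₁ hC hr t' ht' t ht⟩
    · rintro p q r q₁ r₁ hC₁ hqr - - ⟨u, hu, hu'⟩ hC₂ t ⟨⟨a, ha, ha'⟩, ⟨v, hv⟩, hC₃⟩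
        t' ⟨⟨b, hb, hb'⟩, ⟨v', hv'⟩, hC₄⟩
      obtain ⟨e₁, he₁, hpe₁, hq₁⟩ := hC₁.exists_long k
      obtain ⟨e₂, he₂, hpe₂, hr₁⟩ := hC₂.exists_long k
      obtain ⟨f, hf, hqf, hrf⟩ := hqr.exists_long k
      obtain ⟨g, hg, hqg, ht⟩ := hC₃.exists_long k
      obtain ⟨h, hh, hrh, ht'⟩ := hC₄.exists_long k
      have hback : deltaStar δ (deltaStar δ q₁ e₂) e₁ = q₁ := by
        have := swap p (a ++ u) [] e₂ he₁ he₁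
        simpa only [deltaStar_append, deltaStar_nil, hpe₁, hpe₂, ha, hu, hq₁] using this
      have hmid : deltaStar δ t' f = deltaStar δ t f := by
        have := swap p a u (e₁ ++ b) he₂ hf
        simpa only [deltaStar_append, hpe₂, ha, hqf, hu, hback, hb', hpe₁, hb, hrf, hu', hr₁,
          ha'] using this
      have htg : deltaStar δ (deltaStar δ t f) g = t := by
        have := swap q v [] f hg hg
        simpa only [deltaStar_nil, hqg, hv, ht, hqf] using this
      have hth : deltaStar δ (deltaStar δ t' f) h = t' := by
        have := swap r v' [] f hh hh
        simpa only [deltaStar_nil, hrh, hv', ht', hrf] using this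
      exact ⟨⟨f ++ h, by rw [deltaStar_append, ← hmid, hth]⟩,
        ⟨f ++ g, by rw [deltaStar_append, hmid, htg]⟩⟩
  · rintro ⟨h₁, h₂, -, h₄⟩
    exact locallyThresholdTestable_of_invariants h₁ (stateSwap_of_conditions h₁ h₂ h₄) q0 Fset
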